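/- For every n ≥ 0 and every i = 0,…,d−1, the coefficient c_{(n),i} lies in C[𝔭^{n+1}] but not in C[𝔭^n]; that is, 𝔠_{𝔭^{n+1}}(c_{(n),i}) = 0 but 𝔠_{𝔭^n}(c_{(n),i}) ≠ 0. In particular, c_{(n),i} ≠ 0 for all n ≥ 0 and all i = 0,…,d−1. -/

import Mathlib

open Polynomial Filter Topology

theorem HasSum.of_eq {ι L : Type*} [AddCommMonoid L] [TopologicalSpace L] {f g : ι → L}
    {a b : L} (h : HasSum f a) (hf : ∀ i, g i = f i) (hb : b = a) : HasSum g b := by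
  rwa [funext hf, hb]

theorem norm_map_le_one_of_finite {L K : Type*} [NormedField L] [Field K] [Fintype K]
    (f : K →+* L) (x : K) : ‖f x‖ ≤ 1 := by
  by_contra! h
  have h1 : ‖f x‖ ^ Fintype.card K = ‖f x‖ := by
    rw [← norm_pow, ← map_pow, FiniteField.pow_card]
  have h2 := pow_lt_pow_right₀ h (Fintype.one_lt_card (α := K))
  rw [pow_one, h1] at h2
  exact lt_irrefl _ h2

theorem eq_zero_of_hasSum_mul_pow {L : Type*} [NormedField L] [IsUltrametricDist L]
    {θ : L} (hθ : 1 < ‖θ‖) {a : ℕ → L}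
    (h : ∀ z : L, ‖z‖ ≤ 1 → HasSum (fun i => a i * z ^ i) 0) (m : ℕ) : a m = 0 := by
  have hlim : Tendsto a atTop (𝓝 0) := by
    simpa using (h 1 (by simp)).summable.tendsto_atTop_zero
  obtain ⟨B, hB⟩ := (isBounded_iff_forall_norm_le.1 (Metric.isBounded_range_of_tendsto a hlim))
  replace hB : ∀ i, ‖a i‖ ≤ B := fun i => hB _ ⟨i, rfl⟩
  have hB0 : 0 ≤ B := (norm_nonneg _).trans (hB 0)
  induction m using Nat.strong_induction_on with
  | _ m ih =>
    have key : ∀ z : L, z ≠ 0 → ‖z‖ ≤ 1 → ‖a m‖ ≤ ‖z‖ * B := by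
      intro z hz0 hz
      have h1 := (hasSum_nat_add_iff' m).2 (h z hz)
      rw [Finset.sum_eq_zero (fun i hi => by rw [ih i (Finset.mem_range.1 hi), zero_mul]),
        sub_zero] at h1
      have h2 := (hasSum_nat_add_iff' 1).2 (h1.mul_left ((z ^ m)⁻¹))
      simp only [Finset.sum_range_one, zero_add, mul_zero, zero_sub] at h2
      have h3 : (z ^ m)⁻¹ * (a m * z ^ m) = a m := by field_simp
      rw [h3] at h2
      rw [← norm_neg, ← h2.tsum_eq]
      refine IsUltrametricDist.norm_tsum_le_of_forall_le_of_nonneg (by positivity) fun i => ?_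
      have h4 : (z ^ m)⁻¹ * (a (i + 1 + m) * z ^ (i + 1 + m)) = z * (a (i + 1 + m) * z ^ i) := by
        field_simp
        ring
      rw [h4, norm_mul, norm_mul, norm_pow]
      gcongr
      exact (mul_le_of_le_one_right (norm_nonneg _) (pow_le_one₀ (norm_nonneg _) hz)).trans (hB _)
    have hθ0 : θ ≠ 0 := norm_pos_iff.1 (by linarith)
    have hlim2 : Tendsto (fun N : ℕ => (‖θ‖⁻¹) ^ N * B) atTop (𝓝 (0 * B)) :=
      (tendsto_pow_atTop_nhds_zero_of_lt_one (by positivity) (inv_lt_one_of_one_lt₀ hθ)).mul_const B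
    rw [zero_mul] at hlim2
    have := ge_of_tendsto' hlim2 (b := ‖a m‖) fun N => by
      have := key (θ⁻¹ ^ N) (by positivity) (by
        rw [norm_pow, norm_inv]
        exact pow_le_one₀ (by positivity) (inv_le_one_of_one_le₀ hθ.le))
      simpa using this
    exact norm_le_zero_iff.1 this

theorem norm_one_sub_div_eq_one {L : Type*} [NormedField L] [IsUltrametricDist L]
    {θ : L} (hθ : 1 < ‖θ‖) {z : L} (hz : ‖z‖ ≤ 1) {m : ℕ} (hm : m ≠ 0) :
    ‖1 - z / θ ^ m‖ = 1 := by
  have h : ‖z / θ ^ m‖ < 1 := by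
    rw [norm_div, norm_pow]
    have := one_lt_pow₀ hθ hm
    rw [div_lt_one (by linarith)]
    linarith
  have := IsUltrametricDist.norm_sub_eq_max_of_norm_sub_ne_norm_sub 1 0 (z / θ ^ m)
    (by simpa using h.ne')
  rw [sub_zero, norm_one, zero_sub, norm_neg, max_eq_left h.le] at this
  exact this

theorem hasProd_norm_eq_one {L : Type*} [NormedField L] [IsUltrametricDist L]
    {θ : L} (hθ : 1 < ‖θ‖) {z : L} (hz : ‖z‖ ≤ 1) {q : ℕ} (hq : q ≠ 0) {P : L}
    (hP : HasProd (fun j : ℕ => (1 - z / θ ^ q ^ j)⁻¹) P) : ‖P‖ = 1 := by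
  have h := hP.norm
  simp only [norm_inv, norm_one_sub_div_eq_one hθ hz (pow_ne_zero _ hq), inv_one] at h
  exact h.unique hasProd_one

/-- The coefficient form of the functional equation `ω^τ = (z - θ) ω`. -/
theorem coeff_functional_equation {L : Type*} [NormedField L] [IsUltrametricDist L]
    [IsAlgClosed L] {θ : L} (hθ : 1 < ‖θ‖) {p κ : ℕ} [CharP L p] (hp : p.Prime)
    {lamθ : L} (hlamθ : lamθ ^ (p ^ κ - 1) = -θ) {w : ℕ → L}
    (hω : ∀ z : L, ‖z‖ ≤ 1 → ∃ P : L,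
      HasProd (fun j : ℕ => (1 - z / θ ^ (p ^ κ) ^ j)⁻¹) P ∧
      HasSum (fun i : ℕ => w i * z ^ i) (lamθ * P)) :
    w 0 ^ p ^ κ + θ * w 0 = 0 ∧ ∀ i, w (i + 1) ^ p ^ κ + θ * w (i + 1) = w i := by
  have := Fact.mk hp
  have : ExpChar L p := ExpChar.prime hp
  set q := p ^ κ with hq
  have hq0 : 0 < q := pow_pos hp.pos _
  have hθ0 : θ ≠ 0 := norm_pos_iff.1 (by linarith)
  have key : ∀ y : L, ‖y‖ ≤ 1 → HasSum
      (fun i => (w i ^ q + θ * w i - (if i = 0 then 0 else w (i - 1))) * y ^ i) 0 := by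
    intro y hy
    obtain ⟨z, rfl⟩ := IsAlgClosed.exists_pow_nat_eq y hq0
    have hz : ‖z‖ ≤ 1 := by
      rw [norm_pow] at hy
      exact (pow_le_one_iff_of_nonneg (norm_nonneg _) hq0.ne').1 hy
    obtain ⟨P, hP, hS⟩ := hω z hz
    obtain ⟨P', hP', hS'⟩ := hω _ hy
    have h1 : HasProd (fun j : ℕ => (1 - z ^ q / θ ^ q ^ (j + 1))⁻¹) (P ^ q) := by
      have h := hP.map (powMonoidHom q) (continuous_pow q)
      rw [powMonoidHom_apply] at h
      convert h using 1
      funext j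
      simp only [Function.comp, powMonoidHom_apply]
      rw [inv_pow, hq, sub_pow_expChar_pow, one_pow, div_pow, ← pow_mul θ, ← pow_succ]
    have h2 : P' = (1 - z ^ q / θ)⁻¹ * P ^ q := by
      have := HasProd.zero_mul (f := fun j : ℕ => (1 - z ^ q / θ ^ q ^ j)⁻¹) h1
      simp only [pow_zero, pow_one] at this
      exact hP'.unique this
    have h3 : (1 - z ^ q / θ) ≠ 0 := by
      have := norm_one_sub_div_eq_one hθ hy one_ne_zero
      rw [pow_one] at this
      exact norm_ne_zero_iff.1 (by rw [this]; exact one_ne_zero)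
    have h4 : (lamθ * P) ^ q = (z ^ q - θ) * (lamθ * P') := by
      have : lamθ ^ q = lamθ * -θ := by
        rw [← hlamθ, ← pow_succ', Nat.sub_add_cancel hq0]
      rw [mul_pow, this, h2]
      have h5 : z ^ q - θ = -θ * (1 - z ^ q / θ) := by field_simp; ring
      rw [h5]
      calc lamθ * -θ * P ^ q = -θ * lamθ * P ^ q * ((1 - z ^ q / θ) * (1 - z ^ q / θ)⁻¹) := by
            rw [mul_inv_cancel₀ h3]; ring
        _ = _ := by ring
    have h6 : HasSum (fun i => w i ^ q * (z ^ q) ^ i) ((lamθ * P) ^ q) := by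
      refine (hS.map (iterateFrobenius L p κ) ?_).of_eq (fun i => ?_) ?_
      · exact (continuous_pow q).congr fun x => (iterateFrobenius_def ..).symm
      · simp only [Function.comp, iterateFrobenius_def]
        rw [← hq, mul_pow, ← pow_mul, ← pow_mul, mul_comm q]
      · rw [iterateFrobenius_def]
    have h7 : HasSum (fun i => (if i = 0 then 0 else w (i - 1)) * (z ^ q) ^ i)
        (z ^ q * (lamθ * P')) := by
      rw [← hasSum_nat_add_iff' 1]
      refine (hS'.mul_left (z ^ q)).of_eq (fun i => ?_) (by simp)
      rw [if_neg (Nat.succ_ne_zero i), Nat.add_sub_cancel]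
      ring
    refine ((h6.add (hS'.mul_left θ)).sub h7).of_eq (fun i => ?_) ?_
    · ring
    · rw [h4]; ring
  have h := eq_zero_of_hasSum_mul_pow hθ key
  refine ⟨by simpa using h 0, fun i => ?_⟩
  simpa [sub_eq_zero] using h (i + 1)

/-- The value `∑ₘ φ(Xᵐ) wₘ` attached to a linear functional `φ` on polynomials. -/
noncomputable def dualSum {𝔽 L : Type*} [Field 𝔽] [NormedField L] [Algebra 𝔽 L] (w : ℕ → L)
    (φ : 𝔽[X] →ₗ[𝔽] 𝔽) : L :=
  ∑' m, algebraMap 𝔽 L (φ (X ^ m)) * w m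

theorem dualSum_zero {𝔽 L : Type*} [Field 𝔽] [NormedField L] [Algebra 𝔽 L] {w : ℕ → L} :
    dualSum w (0 : 𝔽[X] →ₗ[𝔽] 𝔽) = 0 := by
  simp [dualSum]

section DualSum

variable {𝔽 L : Type*} [Field 𝔽] [Fintype 𝔽] [NormedField L] [CompleteSpace L]
  [IsUltrametricDist L] [Algebra 𝔽 L] {w : ℕ → L}

theorem hasSum_dualSum (hw : Tendsto w atTop (𝓝 0)) (φ : 𝔽[X] →ₗ[𝔽] 𝔽) :
    HasSum (fun m => algebraMap 𝔽 L (φ (X ^ m)) * w m) (dualSum w φ) := by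
  refine (NonarchimedeanAddGroup.summable_of_tendsto_cofinite_zero ?_).hasSum
  rw [Nat.cofinite_eq_atTop]
  refine squeeze_zero_norm (fun m => ?_) (tendsto_zero_iff_norm_tendsto_zero.1 hw)
  rw [norm_mul]
  exact mul_le_of_le_one_left (norm_nonneg _) (norm_map_le_one_of_finite _ _)

theorem dualSum_add (hw : Tendsto w atTop (𝓝 0)) (φ ψ : 𝔽[X] →ₗ[𝔽] 𝔽) :
    dualSum w (φ + ψ) = dualSum w φ + dualSum w ψ :=
  (hasSum_dualSum hw _).unique <|
    ((hasSum_dualSum hw φ).add (hasSum_dualSum hw ψ)).of_eq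
      (fun m => by rw [LinearMap.add_apply, map_add, add_mul]) rfl

theorem dualSum_smul (hw : Tendsto w atTop (𝓝 0)) (s : 𝔽) (φ : 𝔽[X] →ₗ[𝔽] 𝔽) :
    dualSum w (s • φ) = algebraMap 𝔽 L s * dualSum w φ :=
  (hasSum_dualSum hw _).unique <|
    ((hasSum_dualSum hw φ).mul_left (algebraMap 𝔽 L s)).of_eq
      (fun m => by rw [LinearMap.smul_apply, smul_eq_mul, map_mul, mul_assoc]) rfl

theorem carlitz_X_dualSum (hw : Tendsto w atTop (𝓝 0)) {p κ : ℕ} [ExpChar L p]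
    (hcard : Fintype.card 𝔽 = p ^ κ) {θ : L} (h0 : w 0 ^ p ^ κ + θ * w 0 = 0)
    (h1 : ∀ i, w (i + 1) ^ p ^ κ + θ * w (i + 1) = w i) (φ : 𝔽[X] →ₗ[𝔽] 𝔽) :
    dualSum w φ ^ p ^ κ + θ * dualSum w φ = dualSum w (φ ∘ₗ LinearMap.mulLeft 𝔽 X) := by
  have hs := hasSum_dualSum hw φ
  have hpow : ∀ s : 𝔽, algebraMap 𝔽 L s ^ p ^ κ = algebraMap 𝔽 L s := fun s => by
    rw [← map_pow, ← hcard, FiniteField.pow_card]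
  have hfrob : HasSum (fun m => algebraMap 𝔽 L (φ (X ^ m)) * w m ^ p ^ κ)
      (dualSum w φ ^ p ^ κ) := by
    refine (hs.map (iterateFrobenius L p κ) ?_).of_eq (fun m => ?_) ?_
    · exact (continuous_pow (p ^ κ)).congr fun x => (iterateFrobenius_def ..).symm
    · simp only [Function.comp, iterateFrobenius_def]
      rw [mul_pow, hpow]
    · rw [iterateFrobenius_def]
  have h := (hasSum_nat_add_iff' 1).2 (hfrob.add (hs.mul_left θ))
  have hzero : ∀ s : L, s * w 0 ^ p ^ κ + θ * (s * w 0) = 0 := fun s => by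
    linear_combination s * h0
  rw [Finset.sum_range_one, hzero, sub_zero] at h
  refine h.unique ((hasSum_dualSum hw _).of_eq (fun m => ?_) rfl)
  rw [LinearMap.comp_apply, LinearMap.mulLeft_apply, ← pow_succ', ← h1 m]
  ring

theorem carlitz_dualSum (hw : Tendsto w atTop (𝓝 0)) {p κ : ℕ} [ExpChar L p]
    (hcard : Fintype.card 𝔽 = p ^ κ) {θ : L} (h0 : w 0 ^ p ^ κ + θ * w 0 = 0)
    (h1 : ∀ i, w (i + 1) ^ p ^ κ + θ * w (i + 1) = w i) {𝔠 : 𝔽[X] → L → L}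
    (hc_add : ∀ a b : 𝔽[X], ∀ x : L, 𝔠 (a + b) x = 𝔠 a x + 𝔠 b x)
    (hc_mul : ∀ a b : 𝔽[X], ∀ x : L, 𝔠 (a * b) x = 𝔠 a (𝔠 b x))
    (hc_C : ∀ (s : 𝔽) (x : L), 𝔠 (C s) x = algebraMap 𝔽 L s * x)
    (hc_X : ∀ x : L, 𝔠 X x = x ^ p ^ κ + θ * x) (a : 𝔽[X]) (φ : 𝔽[X] →ₗ[𝔽] 𝔽) :
    𝔠 a (dualSum w φ) = dualSum w (φ ∘ₗ LinearMap.mulLeft 𝔽 a) := by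
  induction a using Polynomial.induction_on generalizing φ with
  | C s =>
    rw [hc_C, ← dualSum_smul hw]
    congr 1
    refine LinearMap.ext fun f => ?_
    simp [← smul_eq_C_mul]
  | add a b iha ihb =>
    rw [hc_add, iha, ihb, ← dualSum_add hw]
    congr 1
    refine LinearMap.ext fun f => ?_
    simp [add_mul]
  | monomial n s ih =>
    rw [pow_succ, ← mul_assoc, hc_mul, hc_X, carlitz_X_dualSum hw hcard h0 h1, ih]
    congr 1
    refine LinearMap.ext fun f => ?_
    simp only [LinearMap.comp_apply, LinearMap.mulLeft_apply]
    congr 1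
    ring

end DualSum

section HasseDeriv

variable {𝔽 K : Type*} [Field 𝔽] [Field K] [Algebra 𝔽 K]

theorem aeval_hasseDeriv (x : K) (n : ℕ) (f : 𝔽[X]) :
    aeval x (hasseDeriv n f) = (taylor x (f.map (algebraMap 𝔽 K))).coeff n := by
  rw [taylor_coeff, ← eval_map_algebraMap]
  congr 1
  ext m
  simp [hasseDeriv_coeff]

theorem X_dvd_taylor_of_aeval_eq_zero {x : K} {P : 𝔽[X]} (hP : aeval x P = 0) :
    X ∣ taylor x (P.map (algebraMap 𝔽 K)) := by
  rw [X_dvd_iff, taylor_coeff_zero, eval_map_algebraMap, hP]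

theorem aeval_hasseDeriv_pow_succ_mul {x : K} {P : 𝔽[X]} (hP : aeval x P = 0) (n : ℕ)
    (f : 𝔽[X]) : aeval x (hasseDeriv n (P ^ (n + 1) * f)) = 0 := by
  obtain ⟨S, hS⟩ := X_dvd_taylor_of_aeval_eq_zero hP
  rw [aeval_hasseDeriv, Polynomial.map_mul, Polynomial.map_pow, taylor_mul, taylor_pow, hS,
    mul_pow, mul_assoc, coeff_X_pow_mul', if_neg (by omega)]

theorem aeval_hasseDeriv_pow_mul {x : K} {P : 𝔽[X]} (hP : aeval x P = 0) (n : ℕ)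
    (f : 𝔽[X]) :
    aeval x (hasseDeriv n (P ^ n * f)) = aeval x (derivative P) ^ n * aeval x f := by
  obtain ⟨S, hS⟩ := X_dvd_taylor_of_aeval_eq_zero hP
  have hS0 : S.coeff 0 = aeval x (derivative P) := by
    rw [← hasseDeriv_one, aeval_hasseDeriv, hS, coeff_X_mul]
  rw [aeval_hasseDeriv, Polynomial.map_mul, Polynomial.map_pow, taylor_mul, taylor_pow, hS,
    mul_pow, mul_assoc, coeff_X_pow_mul', if_pos le_rfl, Nat.sub_self, mul_coeff_zero,
    coeff_zero_eq_eval_zero (S ^ n), eval_pow, ← coeff_zero_eq_eval_zero, hS0,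
    taylor_coeff_zero, eval_map_algebraMap]

end HasseDeriv

/-- Twisting a nonzero functional on a finite extension by multiplications yields all of them. -/
theorem exists_comp_mulLeft_eq {𝔽 K : Type*} [Field 𝔽] [Field K] [Algebra 𝔽 K]
    [FiniteDimensional 𝔽 K] {ψ : K →ₗ[𝔽] 𝔽} (hψ : ψ ≠ 0) (χ : K →ₗ[𝔽] 𝔽) :
    ∃ y : K, ψ ∘ₗ LinearMap.mulLeft 𝔽 y = χ := by
  let T : K →ₗ[𝔽] Module.Dual 𝔽 K := (LinearMap.llcomp 𝔽 K K 𝔽 ψ) ∘ₗ LinearMap.mul 𝔽 K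
  have hT : Function.Injective T := by
    rw [← LinearMap.ker_eq_bot, LinearMap.ker_eq_bot']
    intro y hy
    by_contra hy0
    refine hψ (LinearMap.ext fun f => ?_)
    have := LinearMap.congr_fun hy (y⁻¹ * f)
    simpa [T, mul_inv_cancel_left₀ hy0] using this
  obtain ⟨y, hy⟩ := (LinearMap.injective_iff_surjective_of_finrank_eq_finrank
    (Subspace.dual_finrank_eq (K := 𝔽) (V := K)).symm).1 hT χ
  exact ⟨y, hy⟩

section Coordinates

variable {𝔽 L K ι : Type*} [Field 𝔽] [Fintype 𝔽] [NormedField L] [CompleteSpace L]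
  [IsUltrametricDist L] [Algebra 𝔽 L] [Field K] [Algebra 𝔽 K] [Fintype ι] {w : ℕ → L}

theorem hasSum_hasseDeriv_eq_sum_dualSum (hw : Tendsto w atTop (𝓝 0))
    (b : Module.Basis ι 𝔽 K) (x : K) (σ : K →ₐ[𝔽] L) (n : ℕ) :
    HasSum (fun i : ℕ => ((i + n).choose n : L) * w (i + n) * σ x ^ i)
      (∑ j, dualSum w (b.coord j ∘ₗ (aeval x).toLinearMap ∘ₗ hasseDeriv n) * σ (b j)) := by
  have hσ : ∀ y : K, σ y = ∑ j, algebraMap 𝔽 L (b.coord j y) * σ (b j) := fun y => by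
    conv_lhs => rw [← b.sum_repr y, map_sum]
    refine Finset.sum_congr rfl fun j _ => ?_
    rw [map_smul, Algebra.smul_def, Module.Basis.coord_apply]
  have hX : ∀ m : ℕ, aeval x (hasseDeriv n (X ^ m : 𝔽[X])) = (m.choose n : K) * x ^ (m - n) := by
    intro m
    rw [X_pow_eq_monomial, hasseDeriv_monomial, aeval_monomial]
    simp
  have h : HasSum (fun m => w m * σ ((m.choose n : K) * x ^ (m - n)))
      (∑ j, dualSum w (b.coord j ∘ₗ (aeval x).toLinearMap ∘ₗ hasseDeriv n) * σ (b j)) := by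
    refine (hasSum_sum fun j _ => (hasSum_dualSum hw
      (b.coord j ∘ₗ (aeval x).toLinearMap ∘ₗ hasseDeriv n)).mul_right (σ (b j))).of_eq
      (fun m => ?_) rfl
    rw [hσ, Finset.mul_sum]
    refine Finset.sum_congr rfl fun j _ => ?_
    rw [LinearMap.comp_apply, LinearMap.comp_apply, AlgHom.toLinearMap_apply, hX]
    ring
  refine ((hasSum_nat_add_iff' n).2 h).of_eq (fun i => ?_) ?_
  · rw [Nat.add_sub_cancel, map_mul, map_natCast, map_pow]
    ring
  · rw [eq_comm, sub_eq_self]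
    refine Finset.sum_eq_zero fun m hm => ?_
    rw [Nat.choose_eq_zero_of_lt (Finset.mem_range.1 hm)]
    simp

theorem dualSum_comp_aeval_ne_zero [FiniteDimensional 𝔽 K] (hw : Tendsto w atTop (𝓝 0))
    {𝔠 : 𝔽[X] → L → L} (h𝔠 : ∀ a φ, 𝔠 a (dualSum w φ) = dualSum w (φ ∘ₗ LinearMap.mulLeft 𝔽 a))
    (h𝔠0 : ∀ a, 𝔠 a 0 = 0) {x : K} (hx : Function.Surjective (aeval x : 𝔽[X] →ₐ[𝔽] K))
    (σ : K →ₐ[𝔽] L) {s : L} (hs : HasSum (fun i => w i * σ x ^ i) s) (hs0 : s ≠ 0)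
    {ψ : K →ₗ[𝔽] 𝔽} (hψ : ψ ≠ 0) : dualSum w (ψ ∘ₗ (aeval x).toLinearMap) ≠ 0 := by
  intro h
  have hall : ∀ χ : K →ₗ[𝔽] 𝔽, dualSum w (χ ∘ₗ (aeval x).toLinearMap) = 0 := by
    intro χ
    obtain ⟨y, rfl⟩ := exists_comp_mulLeft_eq hψ χ
    obtain ⟨a, rfl⟩ := hx y
    have h1 := h𝔠 a (ψ ∘ₗ (aeval x).toLinearMap)
    rw [h, h𝔠0] at h1
    rw [h1]
    congr 1
    refine LinearMap.ext fun f => ?_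
    simp
  refine hs0 (hs.unique ?_)
  refine (hasSum_hasseDeriv_eq_sum_dualSum hw (Module.finBasis 𝔽 K) x σ 0).of_eq
    (fun i => by simp) ?_
  rw [Finset.sum_eq_zero]
  intro j _
  rw [hasseDeriv_zero, LinearMap.comp_id, hall, zero_mul]

end Coordinates

theorem eq_of_sum_mul_pow_eq {R : Type*} [CommRing R] [IsDomain R] {d : ℕ} {v : Fin d → R}
    (hv : Function.Injective v) {a b : Fin d → R}
    (h : ∀ k, ∑ j, a j * v k ^ (j : ℕ) = ∑ j, b j * v k ^ (j : ℕ)) : a = b := by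
  refine sub_eq_zero.1 (Matrix.eq_zero_of_mulVec_eq_zero
    (Matrix.det_vandermonde_ne_zero_iff.2 hv) (funext fun k => ?_))
  simp only [Matrix.mulVec, dotProduct, Matrix.vandermonde_apply, Pi.sub_apply, mul_sub,
    Finset.sum_sub_distrib, Pi.zero_apply]
  rw [sub_eq_zero]
  simpa only [mul_comm] using h k

section Conjugates

variable {𝔽 L : Type*} [Field 𝔽] [Fintype 𝔽] [Field L] [Algebra 𝔽 L] {P : 𝔽[X]} {ζ : L}

theorem aeval_pow_card_pow_eq_zero (hζ : aeval ζ P = 0) (k : ℕ) :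
    aeval (ζ ^ Fintype.card 𝔽 ^ k) P = 0 := by
  induction k with
  | zero => simpa using hζ
  | succ k ih =>
    rw [pow_succ, pow_mul, ← expand_aeval, FiniteField.expand_card, map_pow, ih,
      zero_pow Fintype.card_ne_zero]

theorem injective_pow_card_pow (hP : Irreducible P) (hmonic : P.Monic) (hζ : aeval ζ P = 0)
    {p κ : ℕ} [ExpChar L p] (hcard : Fintype.card 𝔽 = p ^ κ) :
    Function.Injective fun k : Fin P.natDegree => ζ ^ Fintype.card 𝔽 ^ (k : ℕ) := by
  suffices h : ∀ k l : Fin P.natDegree, k < l →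
      ζ ^ Fintype.card 𝔽 ^ (k : ℕ) ≠ ζ ^ Fintype.card 𝔽 ^ (l : ℕ) by
    intro k l hkl
    rcases lt_trichotomy k l with h1 | h1 | h1
    · exact absurd hkl (h k l h1)
    · exact h1
    · exact absurd hkl.symm (h l k h1)
  intro k l hkl heq
  obtain ⟨m, hm⟩ := Nat.exists_eq_add_of_lt (Fin.lt_def.1 hkl)
  have h1 : ζ ^ Fintype.card 𝔽 ^ (m + 1) = ζ := by
    apply iterateFrobenius_inj L p (κ * k)
    rw [iterateFrobenius_def, iterateFrobenius_def, pow_mul, ← hcard, heq, hm, ← pow_mul,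
      ← pow_add]
    congr 2
    omega
  have h2 : P ∣ X ^ Nat.card 𝔽 ^ (m + 1) - X := by
    rw [minpoly.eq_of_irreducible_of_monic hP hζ hmonic]
    apply minpoly.dvd
    rw [Nat.card_eq_fintype_card, map_sub, map_pow, aeval_X, h1, sub_self]
  have h3 := Nat.le_of_dvd (Nat.succ_pos m) (hP.natDegree_dvd_of_dvd_X_pow_card_pow_sub_X h2)
  have := l.isLt
  omega

end Conjugates


/-- Non-vanishing of the torsion coefficients of `ω^{(n)}(ζ)`.
In the Carlitz/Anderson–Thakur setting, write
`ω^{(n)}(ζ_k) = ∑_{i=0}^{d-1} c_{(n),i} ζ_k^i` for all conjugates `ζ_k` of `ζ`.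
Then for every `n ≥ 0` and `0 ≤ i ≤ d-1`, the coefficient `c_{(n),i}` lies in
`C[𝔭^{n+1}]` but not in `C[𝔭^n]`: one has `𝔠_{𝔭^{n+1}}(c_{(n),i}) = 0` but
`𝔠_{𝔭^n}(c_{(n),i}) ≠ 0`.  In particular `c_{(n),i} ≠ 0`. -/
theorem stmt_17 {L : Type*} [NormedField L] [CompleteSpace L] [IsAlgClosed L]
    (hna : IsNonarchimedean (fun x : L => ‖x‖))
    (p q κ : ℕ) (hp : p.Prime) (hκ : 0 < κ) (hq : q = p ^ κ)
    (𝔽 : Type*) [Field 𝔽] [Fintype 𝔽] [Algebra 𝔽 L] (hcard : Fintype.card 𝔽 = q)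
    (θ : L) (hθ : ‖θ‖ = q)
    (𝔠 : Polynomial 𝔽 → L → L)
    (hc_add : ∀ a b : Polynomial 𝔽, ∀ x : L, 𝔠 (a + b) x = 𝔠 a x + 𝔠 b x)
    (hc_mul : ∀ a b : Polynomial 𝔽, ∀ x : L, 𝔠 (a * b) x = 𝔠 a (𝔠 b x))
    (hc_C : ∀ (s : 𝔽) (x : L), 𝔠 (Polynomial.C s) x = algebraMap 𝔽 L s * x)
    (hc_X : ∀ x : L, 𝔠 Polynomial.X x = x ^ q + θ * x)
    (hc_lin : ∀ (a : Polynomial 𝔽) (x y : L), 𝔠 a (x + y) = 𝔠 a x + 𝔠 a y)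
    (hc_smul : ∀ (a : Polynomial 𝔽) (s : 𝔽) (x : L),
      𝔠 a (algebraMap 𝔽 L s * x) = algebraMap 𝔽 L s * 𝔠 a x)
    (lamθ : L) (hlamθ : lamθ ^ (q - 1) = -θ)
    (w : ℕ → L) (hw0 : Filter.Tendsto (fun i => ‖w i‖) Filter.atTop (nhds 0))
    (hωdef : ∀ z : L, ‖z‖ ≤ 1 → ∃ P : L,
      HasProd (fun j : ℕ => (1 - z / θ ^ q ^ j)⁻¹) P ∧
      HasSum (fun i : ℕ => w i * z ^ i) (lamθ * P))
    (Ω : ℕ → L → L)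
    (hΩ : ∀ (n : ℕ) (z : L), ‖z‖ ≤ 1 →
      HasSum (fun i : ℕ => ((i + n).choose n : L) * w (i + n) * z ^ i) (Ω n z))
    (d : ℕ) (hd : 0 < d)
    (𝔭 : Polynomial 𝔽) (hmonic : 𝔭.Monic) (hirr : Irreducible 𝔭)
    (hdeg : 𝔭.natDegree = d)
    (ζ : L) (hζ : Polynomial.aeval ζ 𝔭 = 0)
    (c : ℕ → ℕ → L)
    (hcV : ∀ (n : ℕ) (k : ℕ), k < d →
      Ω n (ζ ^ q ^ k) = ∑ i ∈ Finset.range d, c n i * (ζ ^ q ^ k) ^ i) :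
    ∀ n : ℕ, ∀ i < d,
      𝔠 (𝔭 ^ (n + 1)) (c n i) = 0 ∧
      𝔠 (𝔭 ^ n) (c n i) ≠ 0 ∧
      c n i ≠ 0 := by
  subst hq hdeg
  have : IsUltrametricDist L := IsUltrametricDist.isUltrametricDist_of_isNonarchimedean_norm hna
  have : Fact p.Prime := ⟨hp⟩
  have : CharP 𝔽 p := charP_of_card_eq_prime_pow hcard
  have : CharP L p := charP_of_injective_algebraMap (algebraMap 𝔽 L).injective p
  have : ExpChar L p := ExpChar.prime hp
  have : Fact (Irreducible 𝔭) := ⟨hirr⟩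
  have hθ1 : 1 < ‖θ‖ := by
    rw [hθ]
    exact_mod_cast Nat.one_lt_pow hκ.ne' hp.one_lt
  have hw : Tendsto w atTop (𝓝 0) := tendsto_zero_iff_norm_tendsto_zero.2 hw0
  obtain ⟨h0, h1⟩ := coeff_functional_equation hθ1 hp hlamθ hωdef
  have h𝔠 := carlitz_dualSum hw hcard h0 h1 hc_add hc_mul hc_C hc_X
  have h𝔠0 : ∀ a, 𝔠 a 0 = 0 := fun a => by simpa using hc_lin a 0 0
  let K := AdjoinRoot 𝔭
  let x : K := AdjoinRoot.root 𝔭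
  have hx0 : aeval x 𝔭 = 0 := by rw [AdjoinRoot.aeval_eq, AdjoinRoot.mk_self]
  have hx : Function.Surjective (aeval x : Polynomial 𝔽 →ₐ[𝔽] K) := fun y => by
    obtain ⟨f, rfl⟩ := AdjoinRoot.mk_surjective y
    exact ⟨f, AdjoinRoot.aeval_eq f⟩
  have : FiniteDimensional 𝔽 K := (AdjoinRoot.powerBasis' hmonic).finite
  obtain ⟨b, hb⟩ : ∃ b : Module.Basis (Fin 𝔭.natDegree) 𝔽 K, ∀ j, b j = x ^ (j : ℕ) :=
    ⟨(AdjoinRoot.powerBasis' hmonic).basis, (AdjoinRoot.powerBasis' hmonic).basis_eq_pow⟩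
  have hσ : ∀ z : L, aeval z 𝔭 = 0 → ∃ σ : K →ₐ[𝔽] L, σ x = z := fun z hz =>
    ⟨AdjoinRoot.liftAlgHom 𝔭 (Algebra.ofId 𝔽 L) z hz, AdjoinRoot.liftAlgHom_root ..⟩
  have : Finite K := Module.finite_of_finite 𝔽
  have : Fintype K := Fintype.ofFinite K
  have hc : ∀ n, ∀ i : Fin 𝔭.natDegree,
      c n i = dualSum w (b.coord i ∘ₗ (aeval x).toLinearMap ∘ₗ hasseDeriv n) := by
    intro n
    refine congrFun (eq_of_sum_mul_pow_eq (injective_pow_card_pow hirr hmonic hζ hcard)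
      fun k => ?_)
    obtain ⟨σ, hz⟩ := hσ _ (aeval_pow_card_pow_eq_zero hζ k)
    have hle := norm_map_le_one_of_finite (σ : K →+* L) x
    rw [RingHom.coe_coe, hz, hcard] at hle
    have hs := hasSum_hasseDeriv_eq_sum_dualSum hw b x σ n
    simp only [hb, map_pow, hz] at hs
    rw [hcard] at hs ⊢
    rw [hs.unique (hΩ n _ hle), hcV n k k.isLt, Finset.sum_range]
  intro n i hi
  lift i to Fin 𝔭.natDegree using hi
  have hne : 𝔠 (𝔭 ^ n) (c n i) ≠ 0 := by
    obtain ⟨σ, hz⟩ := hσ ζ hζ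
    have hle := norm_map_le_one_of_finite (σ : K →+* L) x
    obtain ⟨Q, hQ, hs⟩ := hωdef _ hle
    have hQ1 := hasProd_norm_eq_one hθ1 hle (pow_pos hp.pos κ).ne' hQ
    have hlam : lamθ ≠ 0 := by
      rintro rfl
      rw [zero_pow (Nat.sub_ne_zero_of_lt (Nat.one_lt_pow hκ.ne' hp.one_lt)), eq_comm,
        neg_eq_zero] at hlamθ
      rw [hlamθ, norm_zero] at hθ1
      linarith
    have hQ0 : Q ≠ 0 := norm_ne_zero_iff.1 (by rw [hQ1]; exact one_ne_zero)
    have hder : aeval x (derivative 𝔭) ≠ 0 :=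
      (PerfectField.separable_of_irreducible hirr).aeval_derivative_ne_zero hx0
    have hψ : b.coord i ∘ₗ LinearMap.mulLeft 𝔽 (aeval x (derivative 𝔭) ^ n) ≠ 0 := by
      intro h
      have := LinearMap.congr_fun h ((aeval x (derivative 𝔭) ^ n)⁻¹ * b i)
      simp [mul_inv_cancel_left₀ (pow_ne_zero n hder)] at this
    have key := dualSum_comp_aeval_ne_zero hw h𝔠 h𝔠0 hx σ hs (mul_ne_zero hlam hQ0) hψ
    rw [hc, h𝔠]
    convert key using 2
    refine LinearMap.ext fun f => ?_
    simp [aeval_hasseDeriv_pow_mul hx0]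
  refine ⟨?_, hne, fun h => hne (by rw [h, h𝔠0])⟩
  rw [hc, h𝔠, ← dualSum_zero (𝔽 := 𝔽) (w := w)]
  congr 1
  refine LinearMap.ext fun f => ?_
  simp [aeval_hasseDeriv_pow_succ_mul hx0]
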